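/- Let (Z, q) be a striped surface. Then each set U_α = q(S_α \ (X ∪ Y)) and each standard neighborhood N_β = q(nb(X_β)) ∪ q(nb(Y_β)) of a seam is contractible; in particular each U_α and each N_β is path-connected and simply connected. -/

import Mathlib

open Topology
/-- A *model strip* is a subset `S` of `ℝ × [-1,1]` containing the open strip `ℝ × (-1,1)`
which is open in `ℝ × [-1,1]` (equivalently, `S ∩ (ℝ × {-1,1})` is a union of at most
countably many mutually disjoint open intervals). -/
structure IsModelStrip (S : Set (ℝ × ℝ)) : Prop where
  subset_strip : S ⊆ Set.univ ×ˢ Set.Icc (-1 : ℝ) 1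
  ioo_subset : Set.univ ×ˢ Set.Ioo (-1 : ℝ) 1 ⊆ S
  isOpen : ∃ V : Set (ℝ × ℝ), IsOpen V ∧ S = V ∩ (Set.univ ×ˢ Set.Icc (-1 : ℝ) 1)

/-- The boundary part `S ∩ (ℝ × {-1,1})` of a model strip `S`. -/
def stripBoundary (S : Set (ℝ × ℝ)) : Set (ℝ × ℝ) :=
  S ∩ (Set.univ ×ˢ ({-1, 1} : Set ℝ))

/-- A *boundary interval* of a model strip `S` is a connected component of
`S ∩ (ℝ × {-1,1})`. -/
def IsBoundaryInterval (S T : Set (ℝ × ℝ)) : Prop :=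
  ∃ p ∈ stripBoundary S, T = connectedComponentIn (stripBoundary S) p

/-- The copy of a subset `T` of the model strip `S α` inside the disjoint union
`Z₀ = ⨿_α S_α`. -/
def sigmaSet {A : Type} (S : A → Set (ℝ × ℝ)) (α : A) (T : Set (ℝ × ℝ)) :
    Set (Σ a : A, S a) :=
  {z | z.1 = α ∧ (z.2 : ℝ × ℝ) ∈ T}

/-- A *striped atlas* on a space `Z`: a quotient map `q : Z₀ = ⨿_{α ∈ A} S_α → Z` from an at
most countable disjoint union of model strips, together with two disjoint families
`{X_β}_{β ∈ B}`, `{Y_β}_{β ∈ B}` of boundary intervals of the strips, such that `q` is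
injective outside `X ∪ Y`, glues `X_β` onto `Y_β` by embeddings, the images of distinct
`X_β`'s are disjoint, and the image of each `X_β` is disjoint from the image of the
complement of `X ∪ Y`.  A *striped surface* is a surface together with such an atlas. -/
structure StripedAtlas (Z : Type) [TopologicalSpace Z] where
  /-- index set of strips -/
  A : Type
  countable_A : Countable A
  /-- the model strips -/
  S : A → Set (ℝ × ℝ)
  modelStrip : ∀ α, IsModelStrip (S α)
  /-- the gluing quotient map -/
  q : (Σ α : A, S α) → Z
  isQuotientMap : IsQuotientMap q
  /-- index set of pairs of glued boundary intervals -/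
  B : Type
  countable_B : Countable B
  /-- strip containing `X_β` -/
  XA : B → A
  /-- strip containing `Y_β` -/
  YA : B → A
  /-- the boundary interval `X_β` (as a subset of the plane) -/
  Xint : B → Set (ℝ × ℝ)
  /-- the boundary interval `Y_β` (as a subset of the plane) -/
  Yint : B → Set (ℝ × ℝ)
  X_bdry : ∀ b, IsBoundaryInterval (S (XA b)) (Xint b)
  Y_bdry : ∀ b, IsBoundaryInterval (S (YA b)) (Yint b)
  disjoint_XX : ∀ b b', b ≠ b' →
    Disjoint (sigmaSet S (XA b) (Xint b)) (sigmaSet S (XA b') (Xint b'))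
  disjoint_YY : ∀ b b', b ≠ b' →
    Disjoint (sigmaSet S (YA b) (Yint b)) (sigmaSet S (YA b') (Yint b'))
  disjoint_XY : ∀ b b',
    Disjoint (sigmaSet S (XA b) (Xint b)) (sigmaSet S (YA b') (Yint b'))
  injOn : Set.InjOn q
    ((⋃ b, sigmaSet S (XA b) (Xint b)) ∪ ⋃ b, sigmaSet S (YA b) (Yint b))ᶜ
  q_X_eq_q_Y : ∀ b, q '' sigmaSet S (XA b) (Xint b) = q '' sigmaSet S (YA b) (Yint b)
  embed_X : ∀ b, IsEmbedding ((sigmaSet S (XA b) (Xint b)).restrict q)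
  embed_Y : ∀ b, IsEmbedding ((sigmaSet S (YA b) (Yint b)).restrict q)
  seams_disjoint : ∀ b b', b ≠ b' →
    Disjoint (q '' sigmaSet S (XA b) (Xint b)) (q '' sigmaSet S (XA b') (Xint b'))
  seam_disjoint_rest : ∀ b,
    Disjoint (q '' sigmaSet S (XA b) (Xint b))
      (q '' ((⋃ b', sigmaSet S (XA b') (Xint b')) ∪ ⋃ b', sigmaSet S (YA b') (Yint b'))ᶜ)

variable {Z : Type} [TopologicalSpace Z]

/-- The seam `R_β = q(X_β) = q(Y_β)` of a striped atlas. -/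
def StripedAtlas.seam (σ : StripedAtlas Z) (b : σ.B) : Set Z :=
  σ.q '' sigmaSet σ.S (σ.XA b) (σ.Xint b)

/-- The *standard neighborhood* of a boundary interval: for `X = (a,b) × {1}` it is
`(a,b) × (0.8, 1]`, and for `X = (a,b) × {-1}` it is `(a,b) × [-1, -0.8)`. -/
def stdNbhd (T : Set (ℝ × ℝ)) : Set (ℝ × ℝ) :=
  (Prod.fst '' (T ∩ (Set.univ ×ˢ ({1} : Set ℝ)))) ×ˢ Set.Ioc (0.8 : ℝ) 1 ∪
    (Prod.fst '' (T ∩ (Set.univ ×ˢ ({-1} : Set ℝ)))) ×ˢ Set.Ico (-1 : ℝ) (-0.8)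

/-- The union `X ∪ Y` of all glued boundary intervals inside `Z₀ = ⨿_α S_α`. -/
def StripedAtlas.glued (σ : StripedAtlas Z) : Set (Σ α : σ.A, σ.S α) :=
  (⋃ b, sigmaSet σ.S (σ.XA b) (σ.Xint b)) ∪ ⋃ b, sigmaSet σ.S (σ.YA b) (σ.Yint b)

/-- The standard neighborhood `N_β = q(nb(X_β)) ∪ q(nb(Y_β))` of the seam `R_β`. -/
def StripedAtlas.seamNbhd (σ : StripedAtlas Z) (b : σ.B) : Set Z :=
  σ.q '' sigmaSet σ.S (σ.XA b) (stdNbhd (σ.Xint b)) ∪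
    σ.q '' sigmaSet σ.S (σ.YA b) (stdNbhd (σ.Yint b))

/-- The image `U_α = q(S_α \ (X ∪ Y))` of a strip with the glued boundary intervals
removed. -/
def StripedAtlas.stripImage (σ : StripedAtlas Z) (α : σ.A) : Set Z :=
  σ.q '' ({z | z.1 = α} \ σ.glued)

open Set

/-- If `q` is a quotient map and a deformation of the preimage of an open set `N` is compatible
with `q` and ends over a contractible subset of `N`, then `N` is contractible. -/
theorem Topology.IsQuotientMap.contractibleSpace_of_deformation {X Y : Type*} [TopologicalSpace X]
    [TopologicalSpace Y] {q : X → Y} (hq : IsQuotientMap q) {N : Set Y} (hN : IsOpen N)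
    {W : Set X} (hW : q ⁻¹' N = W) (P : W × unitInterval → W) (hP : Continuous P) (hP0 : ∀ w, P (w, 0) = w)
    (hcompat : ∀ w w' : W, q w = q w' → ∀ t, q (P (w, t)) = q (P (w', t)))
    {A : Set Y} (hAN : A ⊆ N) (hA : ContractibleSpace A) (hP1 : ∀ w, q (P (w, 1)) ∈ A) :
    ContractibleSpace N := by
  subst hW
  have hqN := hq.restrictPreimage_isOpen hN
  obtain ⟨s, hs⟩ := hqN.surjective.hasRightInverse
  let g : N × unitInterval → N := fun p => N.restrictPreimage q (P (s p.1, p.2))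
  have hg : ∀ (w : q ⁻¹' N) (t : unitInterval),
      g (N.restrictPreimage q w, t) = N.restrictPreimage q (P (w, t)) := fun w t =>
    Subtype.ext (hcompat _ _ (congrArg Subtype.val (hs (N.restrictPreimage q w))) t)
  have hgc : Continuous g := by
    refine hqN.continuous_lift_prod_left ?_
    simp only [hg]
    exact hqN.continuous.comp hP
  have hg0 : ∀ n, g (n, 0) = n := fun n => by
    obtain ⟨w, rfl⟩ := hqN.surjective n
    rw [hg, hP0]
  have hg1 : ∀ n, (g (n, 1) : Y) ∈ A := fun n => hP1 (s n)
  let r : C(N, A) := ⟨fun n => ⟨g (n, 1), hg1 n⟩, by fun_prop⟩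
  let i : C(A, N) := ⟨fun a => ⟨a, hAN a.2⟩, by fun_prop⟩
  have hid : (ContinuousMap.id N).Homotopic (i.comp r) :=
    ⟨{ toFun := fun p => g (p.2, p.1)
       continuous_toFun := by fun_prop
       map_zero_left := hg0
       map_one_left := fun _ => rfl }⟩
  obtain ⟨y, hy⟩ := ((id_nullhomotopic A).comp_right i).comp_left r
  exact (contractible_iff_id_nullhomotopic N).2 ⟨y, hid.trans hy⟩

section Sigma

variable {A : Type} {S : A → Set (ℝ × ℝ)}

/-- A map into a disjoint union of planar sets is continuous as soon as its index is locally
constant along a continuous map and its planar coordinate is continuous. -/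
theorem continuous_sigma_planar {X : Type*} [TopologicalSpace X] {g f : X → Σ a : A, S a}
    (hg : Continuous g) (hfst : ∀ x, (f x).1 = (g x).1)
    (hsnd : Continuous fun x => ((f x).2 : ℝ × ℝ)) : Continuous f := by
  let _ : TopologicalSpace A := ⊥
  have : DiscreteTopology A := ⟨rfl⟩
  have hind : Topology.IsInducing fun z : Σ a : A, S a => (z.1, (z.2 : ℝ × ℝ)) := by
    refine inducing_sigma.2 ⟨fun a => ?_, fun a => ⟨{a} ×ˢ univ, ?_, fun z => by simp⟩⟩
    · exact (isEmbedding_prodMkRight a).isInducing.comp IsInducing.subtypeVal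
    · exact (isOpen_discrete _).prod isOpen_univ
  have hc : Continuous fun z : Σ a : A, S a => z.1 := continuous_sigma fun a => continuous_const
  refine hind.continuous_iff.2 (Continuous.prodMk ?_ hsnd)
  simp only [hfst]
  exact hc.comp hg

theorem continuous_sigma_coe : Continuous fun z : Σ a : A, S a => (z.2 : ℝ × ℝ) :=
  continuous_sigma fun _ => continuous_subtype_val

theorem mem_sigmaSet {α : A} {T : Set (ℝ × ℝ)} {z : Σ a : A, S a} :
    z ∈ sigmaSet S α T ↔ z.1 = α ∧ (z.2 : ℝ × ℝ) ∈ T := Iff.rfl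

theorem isOpen_sigmaSet {α : A} {T V : Set (ℝ × ℝ)} (hV : IsOpen V) (h : T ∩ S α = V ∩ S α) :
    IsOpen (sigmaSet S α T) := by
  have : sigmaSet S α T = {z | z.1 = α} ∩ (fun z : Σ a : A, S a => (z.2 : ℝ × ℝ)) ⁻¹' V := by
    ext ⟨a, x, hx⟩
    simp only [mem_sigmaSet, mem_inter_iff, mem_ofPred_eq, mem_preimage]
    refine and_congr_right fun ha => ?_
    subst ha
    have := Set.ext_iff.1 h x
    simpa [hx] using this
  rw [this]
  exact (isOpen_sigma_fst_preimage {α}).inter (hV.preimage continuous_sigma_coe)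

/-- A horizontal segment, seen inside the disjoint union, is homeomorphic to its projection. -/
theorem contractibleSpace_sigmaSet_prod {α : A} {J : Set ℝ} {c : ℝ} (hJ : Convex ℝ J)
    (hne : J.Nonempty) (hS : J ×ˢ {c} ⊆ S α) : ContractibleSpace (sigmaSet S α (J ×ˢ {c})) := by
  have := hJ.contractibleSpace hne
  let e : sigmaSet S α (J ×ˢ {c}) ≃ₜ J :=
    { toFun := fun z => ⟨(z.1.2 : ℝ × ℝ).1, z.2.2.1⟩
      invFun := fun x => ⟨⟨α, ⟨(x, c), hS ⟨x.2, rfl⟩⟩⟩, rfl, x.2, rfl⟩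
      left_inv := by
        rintro ⟨⟨a, ⟨x, y⟩, h⟩, ha, hx, hy⟩
        obtain rfl : a = α := ha
        obtain rfl : y = c := hy
        rfl
      right_inv := fun x => rfl
      continuous_toFun := Continuous.subtype_mk
        (continuous_fst.comp (continuous_sigma_coe.comp continuous_subtype_val)) _
      continuous_invFun := Continuous.subtype_mk (continuous_sigmaMk.comp (by fun_prop)) _ }
  exact e.contractibleSpace

end Sigma

/-- A boundary interval of a model strip is an open interval in one of the two boundary lines. -/
theorem IsBoundaryInterval.exists_eq_prod {S T : Set (ℝ × ℝ)} (hS : IsModelStrip S)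
    (hT : IsBoundaryInterval S T) : ∃ (J : Set ℝ) (c : ℝ), (c = 1 ∨ c = -1) ∧ IsOpen J ∧
      Convex ℝ J ∧ J.Nonempty ∧ T = J ×ˢ {c} := by
  obtain ⟨⟨x, c⟩, hp, rfl⟩ := hT
  obtain ⟨V, hV, hSV⟩ := hS.isOpen
  have hc : c = -1 ∨ c = 1 := hp.2.2
  let J₀ : Set ℝ := {t | (t, c) ∈ V}
  have hJ₀ : IsOpen J₀ := hV.preimage (by fun_prop : Continuous fun t : ℝ => (t, c))
  have hxJ : x ∈ J₀ := (hSV ▸ hp.1).1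
  refine ⟨connectedComponentIn J₀ x, c, hc.symm, hJ₀.connectedComponentIn,
    isPreconnected_connectedComponentIn.ordConnected.convex,
    ⟨x, mem_connectedComponentIn hxJ⟩, Subset.antisymm ?_ ?_⟩
  · have hconn := isPreconnected_connectedComponentIn (x := (x, c)) (F := stripBoundary S)
    have hsub := connectedComponentIn_subset (stripBoundary S) (x, c)
    have hmem := mem_connectedComponentIn hp
    have hline : ∀ p ∈ connectedComponentIn (stripBoundary S) (x, c), p.2 = c := by
      intro p h
      have hfin : (Prod.snd '' connectedComponentIn (stripBoundary S) (x, c)).Finite :=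
        (toFinite {-1, 1}).subset (image_subset_iff.2 fun p hp => (hsub hp).2.2)
      have hss : (Prod.snd '' connectedComponentIn (stripBoundary S) (x, c)).Subsingleton :=
        not_nontrivial_iff.1 fun hnt =>
          (hconn.image _ continuous_snd.continuousOn).infinite_of_nontrivial hnt hfin
      exact hss (mem_image_of_mem _ h) (mem_image_of_mem _ hmem)
    have hfst : Prod.fst '' connectedComponentIn (stripBoundary S) (x, c) ⊆
        connectedComponentIn J₀ x := by
      refine (hconn.image _ continuous_fst.continuousOn).subset_connectedComponentIn
        (mem_image_of_mem _ hmem) ?_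
      rintro _ ⟨⟨u, v⟩, h, rfl⟩
      obtain rfl : v = c := hline _ h
      exact (hSV ▸ (hsub h).1 : _ ∈ V ∩ _).1
    exact fun p h => ⟨hfst (mem_image_of_mem _ h), hline p h⟩
  · have : connectedComponentIn J₀ x ×ˢ {c} = (fun t : ℝ => (t, c)) '' connectedComponentIn J₀ x :=
      prod_singleton
    rw [this]
    refine (isPreconnected_connectedComponentIn.image _
      (by fun_prop)).subset_connectedComponentIn
      (mem_image_of_mem _ (mem_connectedComponentIn hxJ)) ?_
    rintro _ ⟨t, ht, rfl⟩
    refine ⟨hSV ▸ ⟨connectedComponentIn_subset J₀ x ht, mem_univ _, ?_⟩, mem_univ _, hc⟩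
    rcases hc with rfl | rfl <;> norm_num

theorem IsBoundaryInterval.subset {S T : Set (ℝ × ℝ)} (hT : IsBoundaryInterval S T) :
    T ⊆ stripBoundary S := by
  obtain ⟨p, hp, rfl⟩ := hT
  exact connectedComponentIn_subset _ _

theorem IsBoundaryInterval.eq_of_mem {S T T' : Set (ℝ × ℝ)} (hT : IsBoundaryInterval S T)
    (hT' : IsBoundaryInterval S T') {p : ℝ × ℝ} (h : p ∈ T) (h' : p ∈ T') : T = T' := by
  obtain ⟨x, -, rfl⟩ := hT
  obtain ⟨y, -, rfl⟩ := hT'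
  rw [connectedComponentIn_eq h, connectedComponentIn_eq h']

theorem mem_stdNbhd_prod {J : Set ℝ} {c : ℝ} (hc : c = 1 ∨ c = -1) {p : ℝ × ℝ} :
    p ∈ stdNbhd (J ×ˢ {c}) ↔ p.1 ∈ J ∧ 0.8 < c * p.2 ∧ c * p.2 ≤ 1 := by
  obtain ⟨x, y⟩ := p
  rcases hc with rfl | rfl
  · norm_num [stdNbhd]
  · norm_num [stdNbhd]
    refine fun _ => ⟨fun h => ⟨by linarith [h.2], by linarith [h.1]⟩,
      fun h => ⟨by linarith [h.2], by linarith [h.1]⟩⟩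

theorem IsBoundaryInterval.subset_stdNbhd {S T : Set (ℝ × ℝ)} (hS : IsModelStrip S)
    (hT : IsBoundaryInterval S T) : T ⊆ stdNbhd T := by
  obtain ⟨J, c, hc, -, -, -, rfl⟩ := hT.exists_eq_prod hS
  rintro ⟨x, y⟩ ⟨hx, rfl : y = c⟩
  refine (mem_stdNbhd_prod hc).2 ⟨hx, ?_⟩
  rcases hc with rfl | rfl <;> norm_num

theorem IsBoundaryInterval.mem_of_mem_stdNbhd {S T : Set (ℝ × ℝ)} (hS : IsModelStrip S)
    (hT : IsBoundaryInterval S T) {p : ℝ × ℝ} (hp : p ∈ stdNbhd T) (hp2 : p.2 = -1 ∨ p.2 = 1) :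
    p ∈ T := by
  obtain ⟨J, c, hc, -, -, -, rfl⟩ := hT.exists_eq_prod hS
  obtain ⟨h, h1, -⟩ := (mem_stdNbhd_prod hc).1 hp
  refine ⟨h, ?_⟩
  rw [mem_singleton_iff]
  rcases hc with rfl | rfl <;> rcases hp2 with h | h <;> rw [h] at h1 ⊢ <;> norm_num at h1

namespace StripedAtlas

variable (σ : StripedAtlas Z)

/-- The union `X_β ∪ Y_β` inside the disjoint union of strips. -/
def gluedPair (b : σ.B) : Set (Σ α : σ.A, σ.S α) :=
  sigmaSet σ.S (σ.XA b) (σ.Xint b) ∪ sigmaSet σ.S (σ.YA b) (σ.Yint b)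

variable {σ}

theorem mem_glued {z : Σ α : σ.A, σ.S α} : z ∈ σ.glued ↔ ∃ b, z ∈ σ.gluedPair b := by
  simp only [glued, gluedPair, mem_union, mem_iUnion, exists_or]

theorem q_mem_seam {b : σ.B} {z : Σ α : σ.A, σ.S α} (hz : z ∈ σ.gluedPair b) :
    σ.q z ∈ σ.seam b := by
  rcases hz with hz | hz
  · exact mem_image_of_mem _ hz
  · exact (σ.q_X_eq_q_Y b).superset (mem_image_of_mem _ hz)

theorem eq_or_mem_gluedPair_of_q_eq {z w : Σ α : σ.A, σ.S α} (h : σ.q z = σ.q w) :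
    z = w ∨ ∃ b, z ∈ σ.gluedPair b ∧ w ∈ σ.gluedPair b := by
  have key : ∀ z w, σ.q z = σ.q w → z ∈ σ.glued → w ∈ σ.glued := by
    intro z w h hz
    by_contra hw
    obtain ⟨b, hb⟩ := mem_glued.1 hz
    exact disjoint_left.1 (σ.seam_disjoint_rest b) (q_mem_seam hb) (h ▸ mem_image_of_mem σ.q hw)
  by_cases hz : z ∈ σ.glued
  · obtain ⟨b, hb⟩ := mem_glued.1 hz
    obtain ⟨b', hb'⟩ := mem_glued.1 (key z w h hz)
    obtain rfl : b = b' := by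
      by_contra hne
      exact disjoint_left.1 (σ.seams_disjoint b b' hne) (q_mem_seam hb) (h ▸ q_mem_seam hb')
    exact .inr ⟨b, hb, hb'⟩
  · exact .inl (σ.injOn hz (fun hw => hz (key w z h.symm hw)) h)

/-- Any glued boundary interval is a boundary interval of the strip containing it. -/
theorem exists_isBoundaryInterval {b : σ.B} {z : Σ α : σ.A, σ.S α} (hz : z ∈ σ.gluedPair b) :
    ∃ T, IsBoundaryInterval (σ.S z.1) T ∧ (z.2 : ℝ × ℝ) ∈ T ∧
      sigmaSet σ.S z.1 T ⊆ σ.gluedPair b := by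
  obtain ⟨a, z⟩ := z
  rcases hz with ⟨ha, hz⟩ | ⟨ha, hz⟩ <;> dsimp only at ha <;> subst ha
  · exact ⟨_, σ.X_bdry b, hz, subset_union_left⟩
  · exact ⟨_, σ.Y_bdry b, hz, subset_union_right⟩

theorem snd_of_mem_glued {z : Σ α : σ.A, σ.S α} (hz : z ∈ σ.glued) :
    (z.2 : ℝ × ℝ).2 = -1 ∨ (z.2 : ℝ × ℝ).2 = 1 := by
  obtain ⟨b, hb⟩ := mem_glued.1 hz
  obtain ⟨T, hT, hzT, -⟩ := exists_isBoundaryInterval hb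
  exact (hT.subset hzT).2.2

theorem isOpen_sigmaSet_stdNbhd {α : σ.A} {T : Set (ℝ × ℝ)}
    (hT : IsBoundaryInterval (σ.S α) T) : IsOpen (sigmaSet σ.S α (stdNbhd T)) := by
  obtain ⟨J, c, hc, hJ, -, -, rfl⟩ := hT.exists_eq_prod (σ.modelStrip α)
  refine isOpen_sigmaSet (V := {p | p.1 ∈ J} ∩ {p | 0.8 < c * p.2})
    ((hJ.preimage continuous_fst).inter (isOpen_lt (by fun_prop) (by fun_prop))) ?_
  ext p
  simp only [mem_inter_iff, mem_stdNbhd_prod hc, mem_ofPred_eq, and_congr_left_iff]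
  intro hp
  have hp := ((σ.modelStrip α).subset_strip hp).2
  have : c * p.2 ≤ 1 := by
    rcases hc with rfl | rfl <;> linarith [hp.1, hp.2]
  tauto

theorem isOpen_strip_diff_glued (α : σ.A) : IsOpen ({z | z.1 = α} \ σ.glued) := by
  refine isOpen_iff_mem_nhds.2 fun z hz => ?_
  obtain ⟨a, p⟩ := z
  obtain ⟨rfl : a = α, hzg⟩ := hz
  by_cases hp : (p : ℝ × ℝ) ∈ stripBoundary (σ.S a)
  · have hT : IsBoundaryInterval (σ.S a) (connectedComponentIn (stripBoundary (σ.S a)) p) :=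
      ⟨p, hp, rfl⟩
    have hpT := mem_connectedComponentIn hp
    have hopen := isOpen_sigmaSet_stdNbhd hT
    generalize connectedComponentIn (stripBoundary (σ.S a)) (p : ℝ × ℝ) = T at hT hpT hopen
    refine Filter.mem_of_superset
      (hopen.mem_nhds ⟨rfl, hT.subset_stdNbhd (σ.modelStrip a) hpT⟩) ?_
    · rintro ⟨a', w⟩ ⟨rfl : a' = a, hw⟩
      refine ⟨rfl, fun hwg => hzg ?_⟩
      obtain ⟨b, hb⟩ := mem_glued.1 hwg
      obtain ⟨T', hT', hwT', hsub⟩ := exists_isBoundaryInterval hb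
      have hwT := hT.mem_of_mem_stdNbhd (σ.modelStrip _) hw (snd_of_mem_glued hwg)
      exact mem_glued.2 ⟨b, hsub ⟨rfl, hT.eq_of_mem hT' hwT hwT' ▸ hpT⟩⟩
  · have hopen : IsOpen (sigmaSet σ.S a (univ ×ˢ Ioo (-1) 1)) :=
      isOpen_sigmaSet (isOpen_univ.prod isOpen_Ioo) rfl
    refine Filter.mem_of_superset (hopen.mem_nhds ⟨rfl, mem_univ _, ?_⟩) ?_
    · have h := ((σ.modelStrip a).subset_strip p.2).2
      refine ⟨h.1.lt_of_ne fun h1 => hp ⟨p.2, mem_univ _, .inl h1.symm⟩,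
        h.2.lt_of_ne fun h1 => hp ⟨p.2, mem_univ _, .inr h1⟩⟩
    · rintro w ⟨hw, -, h⟩
      refine ⟨hw, fun hwg => ?_⟩
      rcases snd_of_mem_glued hwg with h1 | h1
      · exact h.1.ne' h1
      · exact h.2.ne h1

/-- The image of an open saturated set is contractible once a planar deformation, fixing the glued
points, moves the set over a contractible subset of the image. -/
theorem contractibleSpace_image {W : Set (Σ α : σ.A, σ.S α)} (hW : IsOpen W)
    (hsat : ∀ b, ∀ z ∈ σ.gluedPair b, ∀ w ∈ σ.gluedPair b, z ∈ W → w ∈ W)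
    (f : W × unitInterval → ℝ × ℝ) (hf : Continuous f)
    (hfW : ∀ p, ∃ h : f p ∈ σ.S p.1.1.1, ⟨p.1.1.1, f p, h⟩ ∈ W)
    (hf0 : ∀ w, f (w, 0) = w.1.2) (hfix : ∀ w : W, (w : Σ α, σ.S α) ∈ σ.glued →
      ∀ t, f (w, t) = w.1.2)
    {C : Set Z} (hCW : C ⊆ σ.q '' W) (hC : ContractibleSpace C)
    (hf1 : ∀ w, σ.q ⟨w.1.1, f (w, 1), (hfW (w, 1)).1⟩ ∈ C) :
    ContractibleSpace (σ.q '' W) := by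
  have hpre : σ.q ⁻¹' (σ.q '' W) = W := by
    refine Subset.antisymm ?_ (subset_preimage_image _ _)
    rintro z ⟨w, hw, h⟩
    rcases eq_or_mem_gluedPair_of_q_eq h with rfl | ⟨b, hwb, hzb⟩
    · exact hw
    · exact hsat b w hwb z hzb hw
  have hopen : IsOpen (σ.q '' W) := σ.isQuotientMap.isOpen_preimage.1 (hpre.symm ▸ hW)
  refine σ.isQuotientMap.contractibleSpace_of_deformation hopen hpre
    (fun p => ⟨⟨p.1.1.1, f p, (hfW p).1⟩, (hfW p).2⟩) ?_ ?_ ?_ hCW hC hf1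
  · refine Continuous.subtype_mk ?_ _
    exact continuous_sigma_planar (g := fun p : W × unitInterval => p.1.1) (by fun_prop) (fun _ => rfl) hf
  · rintro w
    exact Subtype.ext (Sigma.ext rfl (heq_of_eq (Subtype.ext (hf0 w))))
  · intro w w' h t
    rcases eq_or_mem_gluedPair_of_q_eq h with h | ⟨b, hb, hb'⟩
    · rw [Subtype.ext h]
    · have hq : ∀ v : W, (v : Σ α, σ.S α) ∈ σ.gluedPair b →
          (⟨v.1.1, f (v, t), (hfW (v, t)).1⟩ : Σ α, σ.S α) = v := fun v hv =>
        Sigma.ext rfl (heq_of_eq (Subtype.ext (hfix v (mem_glued.2 ⟨b, hv⟩) t)))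
      dsimp only
      rw [hq w hb, hq w' hb', h]

theorem contractibleSpace_stripImage (α : σ.A) : ContractibleSpace (σ.stripImage α) := by
  have h0 : ((0, 0) : ℝ × ℝ) ∈ σ.S α := (σ.modelStrip α).ioo_subset (by norm_num)
  have h0W : (⟨α, (0, 0), h0⟩ : Σ α, σ.S α) ∈ {z | z.1 = α} \ σ.glued :=
    ⟨rfl, fun h => by simpa using snd_of_mem_glued h⟩
  refine contractibleSpace_image (isOpen_strip_diff_glued α)
    (fun b z hz _ _ h => (h.2 (mem_glued.2 ⟨b, hz⟩)).elim)
    (fun p => (1 - (p.2 : ℝ)) • (p.1.1.2 : ℝ × ℝ)) ?_ ?_ ?_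
    (fun w hw => (w.2.2 hw).elim) (C := {σ.q ⟨α, (0, 0), h0⟩}) ?_ inferInstance ?_
  · have := (continuous_sigma_coe (S := σ.S)).comp
      (continuous_subtype_val (p := (· ∈ {z : Σ α, σ.S α | z.1 = α} \ σ.glued)))
    exact (by fun_prop : Continuous fun p : ({z : Σ α, σ.S α | z.1 = α} \ σ.glued : Set _) × unitInterval =>
      1 - (p.2 : ℝ)).smul (this.comp continuous_fst)
  · rintro ⟨⟨⟨a, ⟨x, y⟩, hp⟩, rfl : a = α, hg⟩, t, ht0, ht1⟩
    rcases ht0.eq_or_lt with rfl | ht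
    · simpa using ⟨hp, hg⟩
    · have hy := ((σ.modelStrip a).subset_strip hp).2
      have h1 : -1 < (1 - t) * y := by nlinarith [hy.1, hy.2]
      have h2 : (1 - t) * y < 1 := by nlinarith [hy.1, hy.2]
      refine ⟨(σ.modelStrip a).ioo_subset ⟨mem_univ _, h1, h2⟩, rfl, fun h => ?_⟩
      rcases snd_of_mem_glued h with h | h
      · exact h1.ne' h
      · exact h2.ne h
  · simp
  · rintro _ rfl
    exact mem_image_of_mem _ h0W
  · rintro ⟨⟨a, p⟩, rfl : a = α, hg⟩
    simp [← Prod.zero_eq_mk]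

theorem contractibleSpace_seam (b : σ.B) : ContractibleSpace (σ.seam b) := by
  obtain ⟨J, c, -, -, hJ, hne, hX⟩ := (σ.X_bdry b).exists_eq_prod (σ.modelStrip _)
  have hC : ContractibleSpace (sigmaSet σ.S (σ.XA b) (σ.Xint b)) := by
    have hsub : σ.Xint b ⊆ σ.S (σ.XA b) := (σ.X_bdry b).subset.trans inter_subset_left
    rw [hX] at hsub ⊢
    exact contractibleSpace_sigmaSet_prod hJ hne hsub
  have := (σ.embed_X b).toHomeomorph.symm.contractibleSpace
  rwa [show range ((sigmaSet σ.S (σ.XA b) (σ.Xint b)).restrict σ.q) = σ.seam b from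
    range_domRestrict _ _] at this

/-- The standard neighborhood of a boundary interval retracts vertically onto the interval. -/
theorem vertical_push_mem {α : σ.A} {T : Set (ℝ × ℝ)} (hT : IsBoundaryInterval (σ.S α) T)
    {p : ℝ × ℝ} (hp : p ∈ stdNbhd T) {t : ℝ} (ht : t ∈ unitInterval) :
    (p.1, (1 - t) * p.2 + t * (p.2 / |p.2|)) ∈ stdNbhd T ∩ σ.S α ∧ (p.1, p.2 / |p.2|) ∈ T := by
  obtain ⟨J, c, hc, -, -, -, rfl⟩ := hT.exists_eq_prod (σ.modelStrip α)
  obtain ⟨h1, h2, h3⟩ := (mem_stdNbhd_prod hc).1 hp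
  have hpc : p.2 / |p.2| = c := by
    rcases hc with rfl | rfl
    · rw [abs_of_pos (by linarith), div_self (by linarith)]
    · rw [abs_of_neg (by linarith), div_neg, div_self (by linarith)]
  have hcc : c * c = 1 := by rcases hc with rfl | rfl <;> norm_num
  have hTS : (p.1, c) ∈ J ×ˢ {c} := ⟨h1, rfl⟩
  rw [hpc]
  have hlow : 0.8 < c * ((1 - t) * p.2 + t * c) := by nlinarith [ht.1, ht.2]
  have hup : c * ((1 - t) * p.2 + t * c) ≤ 1 := by nlinarith [ht.1, ht.2]
  refine ⟨⟨(mem_stdNbhd_prod hc).2 ⟨h1, hlow, hup⟩, ?_⟩, hTS⟩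
  rcases hup.eq_or_lt with h | h
  · have : (1 - t) * p.2 + t * c = c := by
      rcases hc with rfl | rfl <;> linarith
    rw [this]
    exact (hT.subset hTS).1
  · refine (σ.modelStrip α).ioo_subset ⟨mem_univ _, ?_⟩
    constructor <;> rcases hc with rfl | rfl <;> dsimp only <;> linarith

theorem eq_of_mem_gluedPair {b b' : σ.B} {z : Σ α : σ.A, σ.S α} (hz : z ∈ σ.gluedPair b)
    (hz' : z ∈ σ.gluedPair b') : b = b' := by
  by_contra hne
  exact disjoint_left.1 (σ.seams_disjoint b b' hne) (q_mem_seam hz) (q_mem_seam hz')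

theorem contractibleSpace_seamNbhd (b : σ.B) : ContractibleSpace (σ.seamNbhd b) := by
  rw [seamNbhd, ← image_union]
  set W := sigmaSet σ.S (σ.XA b) (stdNbhd (σ.Xint b)) ∪
    sigmaSet σ.S (σ.YA b) (stdNbhd (σ.Yint b))
  have hW : IsOpen W :=
    (isOpen_sigmaSet_stdNbhd (σ.X_bdry b)).union (isOpen_sigmaSet_stdNbhd (σ.Y_bdry b))
  have hpair : σ.gluedPair b ⊆ W := union_subset_union
    (fun _ h => ⟨h.1, (σ.X_bdry b).subset_stdNbhd (σ.modelStrip _) h.2⟩)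
    (fun _ h => ⟨h.1, (σ.Y_bdry b).subset_stdNbhd (σ.modelStrip _) h.2⟩)
  have hloc : ∀ z ∈ W, ∃ T, IsBoundaryInterval (σ.S z.1) T ∧ (z.2 : ℝ × ℝ) ∈ stdNbhd T ∧
      sigmaSet σ.S z.1 T ⊆ σ.gluedPair b ∧ sigmaSet σ.S z.1 (stdNbhd T) ⊆ W := by
    rintro ⟨a, z⟩ (⟨ha, hz⟩ | ⟨ha, hz⟩) <;> dsimp only at ha <;> subst ha
    · exact ⟨_, σ.X_bdry b, hz, subset_union_left, subset_union_left⟩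
    · exact ⟨_, σ.Y_bdry b, hz, subset_union_right, subset_union_right⟩
  have hpush : ∀ z ∈ W, ∀ t ∈ unitInterval,
      (∃ h : ((z.2 : ℝ × ℝ).1, (1 - t) * (z.2 : ℝ × ℝ).2 +
          t * ((z.2 : ℝ × ℝ).2 / |(z.2 : ℝ × ℝ).2|)) ∈ σ.S z.1, ⟨z.1, _, h⟩ ∈ W) ∧
        ∀ h : ((z.2 : ℝ × ℝ).1, (z.2 : ℝ × ℝ).2 / |(z.2 : ℝ × ℝ).2|) ∈ σ.S z.1,
          ⟨z.1, _, h⟩ ∈ σ.gluedPair b := by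
    intro z hz t ht
    obtain ⟨T, hT, hzT, hTb, hTW⟩ := hloc z hz
    obtain ⟨h1, h2⟩ := vertical_push_mem hT hzT ht
    exact ⟨⟨h1.2, hTW ⟨rfl, h1.1⟩⟩, fun _ => hTb ⟨rfl, h2⟩⟩
  have hne : ∀ z ∈ W, |(z.2 : ℝ × ℝ).2| ≠ 0 := by
    intro z hz h0
    obtain ⟨T, hT, hzT, -, -⟩ := hloc z hz
    obtain ⟨J, c, hc, -, -, -, rfl⟩ := hT.exists_eq_prod (σ.modelStrip _)
    have := ((mem_stdNbhd_prod hc).1 hzT).2.1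
    rw [abs_eq_zero.1 h0] at this
    norm_num at this
  refine contractibleSpace_image hW ?_
    (fun p => ((p.1.1.2 : ℝ × ℝ).1, (1 - (p.2 : ℝ)) * (p.1.1.2 : ℝ × ℝ).2 +
      p.2 * ((p.1.1.2 : ℝ × ℝ).2 / |(p.1.1.2 : ℝ × ℝ).2|))) ?_
    (fun p => (hpush p.1.1 p.1.2 p.2 p.2.2).1) (fun w => by simp) ?_
    (C := σ.seam b) ?_ (contractibleSpace_seam b) ?_
  · intro b' z hz w hw hzW
    obtain ⟨T, hT, hzT, hTb, -⟩ := hloc z hzW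
    have hzb := hTb ⟨rfl, hT.mem_of_mem_stdNbhd (σ.modelStrip _) hzT
      (snd_of_mem_glued (mem_glued.2 ⟨b', hz⟩))⟩
    exact hpair (eq_of_mem_gluedPair hz hzb ▸ hw)
  · have hc : Continuous fun p : W × unitInterval => (p.1.1.2 : ℝ × ℝ) :=
      continuous_sigma_coe.comp (by fun_prop)
    have hd := hc.snd.div hc.snd.abs fun p => hne p.1.1 p.1.2
    exact hc.fst.prodMk (((by fun_prop : Continuous fun p : W × unitInterval =>
      1 - (p.2 : ℝ)).mul hc.snd).add ((by fun_prop : Continuous fun p : W × unitInterval =>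
      (p.2 : ℝ)).mul hd))
  · intro w hw t
    refine Prod.ext rfl ?_
    rcases snd_of_mem_glued hw with h | h <;> simp [h]
    ring
  · exact image_mono (subset_union_left.trans hpair)
  · intro w
    have h := hpush w.1 w.2 1 ⟨zero_le_one, le_rfl⟩
    refine q_mem_seam ?_
    convert h.2 ?_ using 1
    · simp
    · simpa using h.1.1

end StripedAtlas

/-- For a striped surface, each set `U_α = q(S_α \ (X ∪ Y))` and each standard neighborhood
`N_β` of a seam is contractible; in particular each of them is path-connected and simply
connected. -/
theorem stripImage_seamNbhd_contractible [T2Space Z] [SecondCountableTopology Z]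
    [ChartedSpace (EuclideanHalfSpace 2) Z] (σ : StripedAtlas Z) :
    (∀ α, ContractibleSpace (σ.stripImage α) ∧ PathConnectedSpace (σ.stripImage α) ∧
      SimplyConnectedSpace (σ.stripImage α)) ∧
      (∀ b, ContractibleSpace (σ.seamNbhd b) ∧ PathConnectedSpace (σ.seamNbhd b) ∧
        SimplyConnectedSpace (σ.seamNbhd b)) := by
  refine ⟨fun α => ?_, fun b => ?_⟩
  · have := σ.contractibleSpace_stripImage α
    exact ⟨this, inferInstance, inferInstance⟩
  · have := σ.contractibleSpace_seamNbhd b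
    exact ⟨this, inferInstance, inferInstance⟩
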